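/- There exists a Carleson measure μ on 𝔻 such that for every function E in the disc algebra 𝒜 for which the measure |E|μ (given by d(|E|μ)(z) = |E(z)| dμ(z)) is a vanishing Carleson measure, E vanishes identically. -/

import Mathlib

open MeasureTheory Filter Set Topology

noncomputable section

/-- The open unit disc in `ℂ`. -/
def unitDisc : Set ℂ := {z : ℂ | ‖z‖ < 1}

/-- The point `e^{iθ}` on the unit circle. -/
def circlePt (θ : ℝ) : ℂ := Complex.exp ((θ : ℂ) * Complex.I)

/-- The Carleson square based on the arc centered at `e^{iθ₀}` of normalized length `t`. -/
def carlesonSquare (θ₀ t : ℝ) : Set ℂ :=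
  {z : ℂ | z ∈ unitDisc ∧ 1 - t ≤ ‖z‖ ∧
    ∃ θ : ℝ, |θ - θ₀| ≤ Real.pi * t ∧ z = (‖z‖ : ℂ) * circlePt θ}

/-- `μ` is a Carleson measure. -/
def IsCarleson (μ : Measure ℂ) : Prop :=
  ∃ C : ℝ, 0 < C ∧ ∀ θ₀ t : ℝ, 0 < t → t ≤ 1 →
    μ (carlesonSquare θ₀ t) ≤ ENNReal.ofReal (C * t)

/-- `μ` is a vanishing Carleson measure. -/
def IsVanishingCarleson (μ : Measure ℂ) : Prop :=
  IsCarleson μ ∧ ∀ ε : ℝ, 0 < ε → ∃ δ : ℝ, 0 < δ ∧ ∀ θ₀ t : ℝ, 0 < t → t < δ →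
    μ (carlesonSquare θ₀ t) ≤ ENNReal.ofReal (ε * t)

/-- The measure `|E| μ`, i.e. `d(|E|μ)(z) = |E(z)| dμ(z)`. -/
def absDensity (E : ℂ → ℂ) (μ : Measure ℂ) : Measure ℂ :=
  μ.withDensity (fun z => ENNReal.ofReal ‖E z‖)

/-- Average of a boundary function (in the angle variable) over the arc
centered at `e^{iθ₀}` of normalized length `t`; `dm = dθ/(2π)`. -/
def arcAvg (f : ℝ → ℂ) (θ₀ t : ℝ) : ℂ :=
  ((2 * Real.pi * t)⁻¹ : ℝ) •
    ∫ θ in Set.Ioo (θ₀ - Real.pi * t) (θ₀ + Real.pi * t), f θ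

/-- Mean oscillation of a boundary function over the arc centered at `e^{iθ₀}`
of normalized length `t`. -/
def meanOsc (f : ℝ → ℂ) (θ₀ t : ℝ) : ℝ :=
  (2 * Real.pi * t)⁻¹ *
    ∫ θ in Set.Ioo (θ₀ - Real.pi * t) (θ₀ + Real.pi * t), ‖f θ - arcAvg f θ₀ t‖

/-- A (2π-periodic, integrable) boundary function has bounded mean oscillation. -/
def IsBMO (f : ℝ → ℂ) : Prop :=
  (∀ θ : ℝ, f (θ + 2 * Real.pi) = f θ) ∧
  IntegrableOn f (Set.Ioc 0 (2 * Real.pi)) ∧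
  ∃ C : ℝ, ∀ θ₀ t : ℝ, 0 < t → t ≤ 1 → meanOsc f θ₀ t ≤ C

/-- A boundary function has vanishing mean oscillation. -/
def IsVMO (f : ℝ → ℂ) : Prop :=
  IsBMO f ∧ ∀ ε : ℝ, 0 < ε → ∃ δ : ℝ, 0 < δ ∧
    ∀ θ₀ t : ℝ, 0 < t → t < δ → meanOsc f θ₀ t ≤ ε

/-- The BMO seminorm of a boundary function. -/
def bmoSeminorm (f : ℝ → ℂ) : ℝ :=
  sSup {c : ℝ | ∃ θ₀ t : ℝ, 0 < t ∧ t ≤ 1 ∧ c = meanOsc f θ₀ t}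

/-- `Fb` is the (a.e.) radial boundary function of `F`. -/
def HasRadialLimits (F : ℂ → ℂ) (Fb : ℝ → ℂ) : Prop :=
  ∀ᵐ θ ∂(volume.restrict (Set.Ioc 0 (2 * Real.pi))),
    Tendsto (fun r : ℝ => F ((r : ℂ) * circlePt θ))
      (nhdsWithin 1 (Set.Iio 1)) (nhds (Fb θ))

/-- `F` is a bounded analytic function on the unit disc. -/
def MemHinf (F : ℂ → ℂ) : Prop :=
  DifferentiableOn ℂ F unitDisc ∧ ∃ M : ℝ, ∀ z ∈ unitDisc, ‖F z‖ ≤ M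

/-- `F` belongs to `QA` with boundary function `Fb`: it is a bounded analytic
function on the disc whose radial boundary values are in VMO. -/
def MemQA (F : ℂ → ℂ) (Fb : ℝ → ℂ) : Prop :=
  MemHinf F ∧ HasRadialLimits F Fb ∧ IsVMO Fb

/-- `E` is an outer function. -/
def IsOuter (E : ℂ → ℂ) : Prop :=
  DifferentiableOn ℂ E unitDisc ∧
  ∃ h : ℝ → ℝ, IntegrableOn h (Set.Ioc 0 (2 * Real.pi)) ∧ ∀ z ∈ unitDisc,
    E z = Complex.exp (((2 * Real.pi)⁻¹ : ℝ) • ∫ θ in Set.Ioc 0 (2 * Real.pi),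
      ((circlePt θ + z) / (circlePt θ - z)) * (h θ : ℂ))

/-- The integral means appearing in the definition of the Hardy space `ℍ^p`. -/
def hardyIntegral (p : ℝ) (F : ℂ → ℂ) (r : ℝ) : ℝ :=
  ∫ θ in Set.Ioc 0 (2 * Real.pi), ‖F ((r : ℂ) * circlePt θ)‖ ^ p

/-- `F` belongs to the Hardy space `ℍ^p`, `0 < p < ∞`. -/
def MemHardy (p : ℝ) (F : ℂ → ℂ) : Prop :=
  DifferentiableOn ℂ F unitDisc ∧
  ∃ M : ℝ, ∀ r : ℝ, 0 < r → r < 1 → hardyIntegral p F r ≤ M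

/-- `F` belongs to `BMOA` with boundary function `Fb`. -/
def MemBMOA (F : ℂ → ℂ) (Fb : ℝ → ℂ) : Prop :=
  MemHardy 2 F ∧ HasRadialLimits F Fb ∧ IsBMO Fb

/-- `F` belongs to `VMOA` with boundary function `Fb`. -/
def MemVMOA (F : ℂ → ℂ) (Fb : ℝ → ℂ) : Prop :=
  MemHardy 2 F ∧ HasRadialLimits F Fb ∧ IsVMO Fb

/-- The generalized Volterra operator `T_G(F)(z) = ∫₀^z F(w) G'(w) dw`. -/
def volterra (G F : ℂ → ℂ) (z : ℂ) : ℂ :=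
  ∫ t in (0:ℝ)..1, z * F ((t : ℂ) * z) * deriv G ((t : ℂ) * z)

/-- Length measure on the radius of the unit disc ending at `e^{iθ}`. -/
def radialMeasure (θ : ℝ) : Measure ℂ :=
  (volume.restrict (Set.Ico (0 : ℝ) 1)).map (fun r : ℝ => (r : ℂ) * circlePt θ)

/-- A weighted sum of the length measures on a dense sequence of radii. -/
def denseRadialMeasure : Measure ℂ :=
  Measure.sum fun k : ℕ => ((2 : ENNReal)⁻¹ ^ k) • radialMeasure (TopologicalSpace.denseSeq ℝ k)

lemma norm_circlePt (θ : ℝ) : ‖circlePt θ‖ = 1 :=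
  Complex.norm_exp_ofReal_mul_I θ

lemma continuous_circlePt : Continuous circlePt := by
  unfold circlePt
  fun_prop

lemma measurable_radius (θ : ℝ) : Measurable (fun r : ℝ => (r : ℂ) * circlePt θ) := by
  fun_prop

lemma radialMeasure_univ (θ : ℝ) : radialMeasure θ univ ≤ 1 := by
  rw [radialMeasure, Measure.map_apply (measurable_radius θ) MeasurableSet.univ]
  simp

lemma measurableSet_unitDisc : MeasurableSet unitDisc :=
  measurableSet_lt measurable_norm measurable_const

lemma radialMeasure_compl_unitDisc (θ : ℝ) : radialMeasure θ unitDiscᶜ = 0 := by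
  have hm := measurable_radius θ measurableSet_unitDisc.compl
  rw [radialMeasure, Measure.map_apply (measurable_radius θ) measurableSet_unitDisc.compl,
    Measure.restrict_apply hm]
  convert measure_empty (μ := (volume : Measure ℝ))
  ext r
  simp only [unitDisc, mem_inter_iff, mem_preimage, mem_compl_iff, mem_ofPred_eq, norm_mul,
    norm_circlePt, mul_one, Complex.norm_real, Real.norm_eq_abs, mem_Ico, mem_empty_iff_false,
    iff_false, not_and]
  intro h h0
  rwa [abs_of_nonneg h0] at h

lemma radialMeasure_annulus_le (θ t : ℝ) :
    radialMeasure θ {z : ℂ | 1 - t ≤ ‖z‖} ≤ ENNReal.ofReal t := by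
  have hs : MeasurableSet {z : ℂ | 1 - t ≤ ‖z‖} := measurableSet_le measurable_const measurable_norm
  rw [radialMeasure, Measure.map_apply (measurable_radius θ) hs,
    Measure.restrict_apply (measurable_radius θ hs)]
  calc _ ≤ volume (Set.Ico (1 - t) 1) := by
        refine measure_mono ?_
        rintro r ⟨h, h0, h1⟩
        simp only [mem_preimage, mem_ofPred_eq, norm_mul, norm_circlePt, mul_one,
          Complex.norm_real, Real.norm_eq_abs, abs_of_nonneg h0] at h
        exact ⟨h, h1⟩
    _ = ENNReal.ofReal t := by simp

lemma denseRadialMeasure_le {s : Set ℂ} (hs : MeasurableSet s) {a : ENNReal}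
    (h : ∀ θ, radialMeasure θ s ≤ a) : denseRadialMeasure s ≤ 2 * a := by
  rw [denseRadialMeasure, Measure.sum_apply _ hs]
  calc _ ≤ ∑' k : ℕ, (2 : ENNReal)⁻¹ ^ k * a :=
        ENNReal.tsum_le_tsum fun k => by
          simpa using mul_le_mul_right (h (TopologicalSpace.denseSeq ℝ k)) ((2 : ENNReal)⁻¹ ^ k)
    _ = 2 * a := by
        rw [ENNReal.tsum_mul_right, ENNReal.tsum_geometric, ENNReal.one_sub_inv_two, inv_inv]

/-- The part of the radius ending at `e^{iθ}` at distance at most `t` from the circle. -/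
def radialSegment (θ t : ℝ) : Set ℂ :=
  {z : ℂ | 1 - t ≤ ‖z‖ ∧ ‖z‖ < 1 ∧ z = (‖z‖ : ℂ) * circlePt θ}

lemma measurableSet_radialSegment (θ t : ℝ) : MeasurableSet (radialSegment θ t) := by
  refine (measurableSet_le measurable_const measurable_norm).inter
    ((measurableSet_lt measurable_norm measurable_const).inter ?_)
  exact measurableSet_eq_fun measurable_id (by fun_prop)

lemma radialSegment_subset_carlesonSquare {θ t : ℝ} (ht : 0 ≤ t) :
    radialSegment θ t ⊆ carlesonSquare θ t := by
  rintro z ⟨h1, h2, h3⟩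
  refine ⟨h2, h1, θ, ?_, h3⟩
  simp only [sub_self, abs_zero]
  positivity

lemma le_radialMeasure_radialSegment {θ t : ℝ} (ht : t ≤ 1) :
    ENNReal.ofReal t ≤ radialMeasure θ (radialSegment θ t) := by
  have hs := measurableSet_radialSegment θ t
  rw [radialMeasure, Measure.map_apply (measurable_radius θ) hs,
    Measure.restrict_apply (measurable_radius θ hs)]
  calc ENNReal.ofReal t = volume (Set.Ico (1 - t) 1) := by simp
    _ ≤ _ := by
        refine measure_mono ?_
        rintro r ⟨h0, h1⟩
        have hr : 0 ≤ r := by linarith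
        refine ⟨?_, hr, h1⟩
        simp [radialSegment, norm_circlePt, abs_of_nonneg hr, h1]
        linarith

lemma le_denseRadialMeasure_radialSegment (k : ℕ) {t : ℝ} (ht : t ≤ 1) :
    ENNReal.ofReal ((2 : ℝ)⁻¹ ^ k * t) ≤
      denseRadialMeasure (radialSegment (TopologicalSpace.denseSeq ℝ k) t) := by
  have hk : ENNReal.ofReal ((2 : ℝ)⁻¹ ^ k) = (2 : ENNReal)⁻¹ ^ k := by
    rw [ENNReal.ofReal_pow (by norm_num), ENNReal.ofReal_inv_of_pos (by norm_num)]
    simp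
  calc _ = (2 : ENNReal)⁻¹ ^ k * ENNReal.ofReal t := by
        rw [ENNReal.ofReal_mul (by positivity), hk]
    _ ≤ (2 : ENNReal)⁻¹ ^ k * radialMeasure (TopologicalSpace.denseSeq ℝ k)
        (radialSegment (TopologicalSpace.denseSeq ℝ k) t) :=
        mul_le_mul_right (le_radialMeasure_radialSegment ht) _
    _ ≤ _ := by
        rw [denseRadialMeasure, Measure.sum_apply _ (measurableSet_radialSegment _ _)]
        exact ENNReal.le_tsum (f := fun j : ℕ =>
          ((2 : ENNReal)⁻¹ ^ j • radialMeasure (TopologicalSpace.denseSeq ℝ j))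
          (radialSegment (TopologicalSpace.denseSeq ℝ k) t)) k

lemma isFiniteMeasure_denseRadialMeasure : IsFiniteMeasure denseRadialMeasure :=
  ⟨(denseRadialMeasure_le MeasurableSet.univ radialMeasure_univ).trans_lt (by simp)⟩

lemma denseRadialMeasure_compl_unitDisc : denseRadialMeasure unitDiscᶜ = 0 := by
  simpa using denseRadialMeasure_le measurableSet_unitDisc.compl
    (fun θ => (radialMeasure_compl_unitDisc θ).le)

lemma isCarleson_denseRadialMeasure : IsCarleson denseRadialMeasure := by
  refine ⟨2, by norm_num, fun θ₀ t _ _ => ?_⟩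
  calc denseRadialMeasure (carlesonSquare θ₀ t)
      ≤ denseRadialMeasure {z : ℂ | 1 - t ≤ ‖z‖} := measure_mono fun z hz => hz.2.1
    _ ≤ 2 * ENNReal.ofReal t :=
        denseRadialMeasure_le (measurableSet_le measurable_const measurable_norm)
          (fun θ => radialMeasure_annulus_le θ t)
    _ = ENNReal.ofReal (2 * t) := by rw [ENNReal.ofReal_mul (by norm_num)]; simp

lemma apply_circlePt_denseSeq_eq_zero {E : ℂ → ℂ}
    (hE : ContinuousOn E (Metric.closedBall 0 1))
    (hv : IsVanishingCarleson (absDensity E denseRadialMeasure)) (k : ℕ) :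
    E (circlePt (TopologicalSpace.denseSeq ℝ k)) = 0 := by
  by_contra hne
  set θ := TopologicalSpace.denseSeq ℝ k
  set c := ‖E (circlePt θ)‖ / 2 with hc_def
  have hc : 0 < c := half_pos (norm_pos_iff.mpr hne)
  obtain ⟨η, hη, hηE⟩ := Metric.continuousOn_iff.mp hE (circlePt θ)
    (by simp [norm_circlePt]) c hc
  obtain ⟨δ, hδ, hδE⟩ := hv.2 (c * (2 : ℝ)⁻¹ ^ k / 2) (by positivity)
  obtain ⟨t, ht, htm⟩ := exists_between (lt_min (lt_min hη hδ) one_pos)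
  obtain ⟨htm, ht1⟩ := lt_min_iff.mp htm
  obtain ⟨htη, htδ⟩ := lt_min_iff.mp htm
  have hlow : ∀ z ∈ radialSegment θ t, ENNReal.ofReal c ≤ ENNReal.ofReal ‖E z‖ := by
    rintro z ⟨h1, h2, h3⟩
    have hd : dist z (circlePt θ) < η := by
      have : z - circlePt θ = ((‖z‖ - 1 : ℝ) : ℂ) * circlePt θ := by
        push_cast
        linear_combination h3
      rw [dist_eq_norm, this, norm_mul, norm_circlePt, mul_one, Complex.norm_real,
        Real.norm_eq_abs, abs_lt]
      constructor <;> linarith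
    have hz := hηE z (by simpa using h2.le) hd
    rw [dist_eq_norm, norm_sub_rev] at hz
    have := norm_sub_norm_le (E (circlePt θ)) (E z)
    exact ENNReal.ofReal_le_ofReal (by linarith)
  have hle : ENNReal.ofReal (c * ((2 : ℝ)⁻¹ ^ k * t)) ≤
      ENNReal.ofReal (c * (2 : ℝ)⁻¹ ^ k / 2 * t) :=
    calc _ = ENNReal.ofReal c * ENNReal.ofReal ((2 : ℝ)⁻¹ ^ k * t) :=
          ENNReal.ofReal_mul hc.le
      _ ≤ ENNReal.ofReal c * denseRadialMeasure (radialSegment θ t) :=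
          mul_le_mul_right (le_denseRadialMeasure_radialSegment k ht1.le) _
      _ = ∫⁻ _ in radialSegment θ t, ENNReal.ofReal c ∂denseRadialMeasure := by simp
      _ ≤ ∫⁻ z in radialSegment θ t, ENNReal.ofReal ‖E z‖ ∂denseRadialMeasure :=
          setLIntegral_mono' (measurableSet_radialSegment θ t) hlow
      _ ≤ absDensity E denseRadialMeasure (radialSegment θ t) := withDensity_apply_le _ _
      _ ≤ absDensity E denseRadialMeasure (carlesonSquare θ t) :=
          measure_mono (radialSegment_subset_carlesonSquare ht.le)
      _ ≤ _ := hδE θ t ht htδ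
  have hpos : 0 < c * ((2 : ℝ)⁻¹ ^ k * t) := by positivity
  rw [ENNReal.ofReal_le_ofReal_iff (by positivity)] at hle
  linarith

/-- Proposition 5.2: there is a Carleson measure `μ` such that any function `E` in
the disc algebra for which `|E|μ` is a vanishing Carleson measure vanishes
identically. -/
theorem stmt_17 :
    ∃ μ : Measure ℂ, IsFiniteMeasure μ ∧ μ unitDiscᶜ = 0 ∧ IsCarleson μ ∧
      ∀ E : ℂ → ℂ, ContinuousOn E (Metric.closedBall 0 1) →
        DifferentiableOn ℂ E unitDisc →
        IsVanishingCarleson (absDensity E μ) →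
        ∀ z ∈ Metric.closedBall (0 : ℂ) 1, E z = 0 := by
  refine ⟨denseRadialMeasure, isFiniteMeasure_denseRadialMeasure,
    denseRadialMeasure_compl_unitDisc, isCarleson_denseRadialMeasure, fun E hE hd hv => ?_⟩
  have hcont : Continuous fun θ => E (circlePt θ) :=
    hE.comp_continuous continuous_circlePt (fun θ => by simp [norm_circlePt])
  have hzero : (fun θ => E (circlePt θ)) = fun _ => 0 :=
    hcont.ext_on (TopologicalSpace.denseRange_denseSeq ℝ) continuous_const (by
      rintro _ ⟨k, rfl⟩
      exact apply_circlePt_denseSeq_eq_zero hE hv k)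
  have hball : unitDisc = Metric.ball (0 : ℂ) 1 := by
    ext z
    simp [unitDisc]
  have hcl : closure (Metric.ball (0 : ℂ) 1) = Metric.closedBall 0 1 :=
    closure_ball 0 one_ne_zero
  have hdc : DiffContOnCl ℂ E (Metric.ball 0 1) := ⟨hball ▸ hd, hcl ▸ hE⟩
  have hfr : EqOn E (fun _ => 0) (frontier (Metric.ball (0 : ℂ) 1)) := by
    intro z hz
    rw [frontier_ball 0 one_ne_zero, mem_sphere_zero_iff_norm] at hz
    have hz' : circlePt z.arg = z := by
      simpa [hz, circlePt] using Complex.norm_mul_exp_arg_mul_I z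
    simpa [hz'] using congrFun hzero z.arg
  have := Complex.eqOn_closure_of_eqOn_frontier Metric.isBounded_ball hdc diffContOnCl_const hfr
  rw [hcl] at this
  exact fun z hz => this hz

end
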